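/- For all fixed k and d there is a constant C (depending only on k and d) such that: for every k-local Hamiltonian H = ∑_{e∈E} h_e on n qudits of local dimension d with m interactions each of operator norm ‖h_e‖_∞ ≤ 1, there exists a pure product state |ψ⟩ = ⊗_{u=1}^n |ψ_u⟩ with ⟨ψ|H|ψ⟩ ≤ min_φ ⟨φ|H|φ⟩ + C·n^{(k−1)/3}·m^{2/3}, where the minimum is over all unit vectors φ in (ℂ^d)^{⊗n}. -/

import Mathlib

open scoped BigOperators ComplexOrder

noncomputable section

namespace QLH

/-- The operator (spectral) norm of a square complex matrix. -/
def opNorm {m : Type*} [Fintype m] [DecidableEq m] (A : Matrix m m ℂ) : ℝ :=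
  ‖Matrix.toEuclideanCLM (𝕜 := ℂ) A‖

/-- A density matrix: positive semidefinite with unit trace. -/
def IsDensity {m : Type*} [Fintype m] (ρ : Matrix m m ℂ) : Prop :=
  ρ.PosSemidef ∧ ρ.trace = 1

/-- The (real) energy `Tr[Hρ]`. -/
def energy {m : Type*} [Fintype m] (H ρ : Matrix m m ℂ) : ℝ :=
  ((H * ρ).trace).re

/-- Von Neumann entropy via eigenvalues. -/
def entropy {m : Type*} [Fintype m] [DecidableEq m] (ρ : Matrix m m ℂ) : ℝ :=
  if h : ρ.IsHermitian then -∑ i, h.eigenvalues i * Real.log (h.eigenvalues i) else 0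

/-- The free-energy functional at inverse temperature `β`. -/
def freeEnergyFun {m : Type*} [Fintype m] [DecidableEq m] (β : ℝ) (H ρ : Matrix m m ℂ) : ℝ :=
  energy H ρ - entropy ρ / β

/-- The free energy: the infimum of the free-energy functional over density matrices. -/
def freeEnergy {m : Type*} [Fintype m] [DecidableEq m] (β : ℝ) (H : Matrix m m ℂ) : ℝ :=
  sInf {x : ℝ | ∃ ρ, IsDensity ρ ∧ x = freeEnergyFun β H ρ}

/-- `A` acts (nontrivially) only on the sites in `e`. -/
def ActsOn {n : ℕ} {α : Type*} [Fintype α] [DecidableEq α]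
    (A : Matrix (Fin n → α) (Fin n → α) ℂ) (e : Finset (Fin n)) : Prop :=
  ∃ M : Matrix ({u // u ∈ e} → α) ({u // u ∈ e} → α) ℂ,
    ∀ x y, A x y =
      (if ∀ u ∉ e, x u = y u then (1 : ℂ) else 0) *
        M (fun u => x u.1) (fun u => y u.1)

/-- Tensor-product (product) state built from single-site matrices. -/
def prodState {n : ℕ} {α : Type*} [Fintype α] (σ : Fin n → Matrix α α ℂ) :
    Matrix (Fin n → α) (Fin n → α) ℂ :=
  fun x y => ∏ u, σ u (x u) (y u)

/-- A separable state: a finite convex combination of product states. -/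
def IsSeparable {n : ℕ} {α : Type*} [Fintype α] [DecidableEq α]
    (σ : Matrix (Fin n → α) (Fin n → α) ℂ) : Prop :=
  ∃ (N : ℕ) (p : Fin N → ℝ) (τ : Fin N → Fin n → Matrix α α ℂ),
    (∀ i, 0 ≤ p i) ∧ (∑ i, p i = 1) ∧ (∀ i u, IsDensity (τ i u)) ∧
    σ = ∑ i, (p i : ℂ) • prodState (τ i)

/-- The rank-one (pure) state `|ψ⟩⟨ψ|` associated to a vector. -/
def vecState {m : Type*} (ψ : m → ℂ) : Matrix m m ℂ :=
  fun x y => ψ x * (starRingEnd ℂ) (ψ y)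

set_option linter.all false
set_option linter.unusedSectionVars false
set_option linter.unusedVariables false

/-! ### Classical part -/

section Classical

variable {V X : Type*} [Fintype V] [DecidableEq V] [Fintype X] [DecidableEq X]

/-- Indicator of agreement on `S`. -/
def agr (S : Finset V) (x z : V → X) : ℝ := if ∀ u ∈ S, z u = x u then 1 else 0

/-- Marginal mass of the cylinder through `x`. -/
def mass (p : (V → X) → ℝ) (S : Finset V) (x : V → X) : ℝ := ∑ z, agr S x z * p z

/-- Conditional expectation given the coordinates in `S`. -/
def cE (p : (V → X) → ℝ) (S : Finset V) (f : (V → X) → ℝ) (x : V → X) : ℝ :=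
  (∑ z, agr S x z * (p z * f z)) / mass p S x

/-- `g` depends only on the coordinates in `S`. -/
def Dep (S : Finset V) (g : (V → X) → ℝ) : Prop :=
  ∀ x x', (∀ u ∈ S, x u = x' u) → g x = g x'

/-- Indicator of `x u = a`. -/
def one (u : V) (a : X) (x : V → X) : ℝ := if x u = a then 1 else 0

lemma agr_nonneg (S : Finset V) (x z : V → X) : 0 ≤ agr S x z := by
  unfold agr; split_ifs <;> norm_num

lemma agr_self (S : Finset V) (x : V → X) : agr S x x = 1 := by simp [agr]

lemma agr_comm (S : Finset V) (x z : V → X) : agr S x z = agr S z x := by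
  simp only [agr, eq_comm]

lemma agr_congr {S : Finset V} {x x' : V → X} (h : ∀ u ∈ S, x u = x' u) (z : V → X) :
    agr S x z = agr S x' z := by
  have : (∀ u ∈ S, z u = x u) ↔ (∀ u ∈ S, z u = x' u) :=
    forall₂_congr fun u hu => by rw [h u hu]
  simp only [agr, this]

lemma mass_congr (p : (V → X) → ℝ) {S : Finset V} {x x' : V → X} (h : ∀ u ∈ S, x u = x' u) :
    mass p S x = mass p S x' := by
  simp only [mass, agr_congr h]

lemma cE_congr (p : (V → X) → ℝ) {S : Finset V} (f : (V → X) → ℝ) {x x' : V → X}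
    (h : ∀ u ∈ S, x u = x' u) : cE p S f x = cE p S f x' := by
  simp only [cE, mass_congr p h, agr_congr h]

lemma cE_dep (p : (V → X) → ℝ) (S : Finset V) (f : (V → X) → ℝ) : Dep S (cE p S f) :=
  fun _ _ h => cE_congr p f h

lemma mass_nonneg {p : (V → X) → ℝ} (hp : ∀ x, 0 ≤ p x) (S : Finset V) (x : V → X) :
    0 ≤ mass p S x :=
  Finset.sum_nonneg fun z _ => mul_nonneg (agr_nonneg _ _ _) (hp z)

lemma mass_pos {p : (V → X) → ℝ} (hp : ∀ x, 0 ≤ p x) (S : Finset V) {x : V → X} (hx : 0 < p x) :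
    0 < mass p S x := by
  refine lt_of_lt_of_le hx ?_
  have := Finset.single_le_sum (f := fun z => agr S x z * p z)
    (fun z _ => mul_nonneg (agr_nonneg _ _ _) (hp z)) (Finset.mem_univ x)
  simpa [agr_self, mass] using this

lemma sum_cE {p : (V → X) → ℝ} (hp : ∀ x, 0 ≤ p x) (S : Finset V) (f G : (V → X) → ℝ)
    (hG : Dep S G) : ∑ x, p x * cE p S f x * G x = ∑ x, p x * f x * G x := by
  have h1 : ∀ x, p x * cE p S f x * G x =
      ∑ z, p z * f z * (agr S x z * (p x * G x / mass p S x)) := by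
    intro x
    simp only [cE, div_eq_mul_inv, Finset.sum_mul, Finset.mul_sum]
    exact Finset.sum_congr rfl fun z _ => by ring
  simp only [h1]
  rw [Finset.sum_comm]
  refine Finset.sum_congr rfl fun z _ => ?_
  rw [← Finset.mul_sum]
  have h2 : ∀ x, agr S x z * (p x * G x / mass p S x) = (agr S z x * p x) * (G z / mass p S z) := by
    intro x
    rw [agr_comm]
    by_cases h : ∀ u ∈ S, x u = z u
    · rw [hG x z h, mass_congr p h]; ring
    · simp [agr, h]
  simp only [h2, ← Finset.sum_mul]
  rcases (hp z).eq_or_lt with h0 | h0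
  · simp [← h0]
  · have := (mass_pos hp S h0).ne'
    change p z * f z * (mass p S z * (G z / mass p S z)) = _
    field_simp

lemma cE_nonneg {p : (V → X) → ℝ} (hp : ∀ x, 0 ≤ p x) (S : Finset V) (f : (V → X) → ℝ)
    (hf : ∀ x, 0 ≤ f x) (x : V → X) : 0 ≤ cE p S f x :=
  div_nonneg (Finset.sum_nonneg fun z _ => mul_nonneg (agr_nonneg _ _ _)
    (mul_nonneg (hp z) (hf z))) (mass_nonneg hp S x)

lemma cE_sum (p : (V → X) → ℝ) (S : Finset V) {ι : Type*} (s : Finset ι) (f : ι → (V → X) → ℝ)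
    (x : V → X) : ∑ i ∈ s, cE p S (f i) x = cE p S (fun z => ∑ i ∈ s, f i z) x := by
  simp only [cE, ← Finset.sum_div, Finset.mul_sum]
  rw [Finset.sum_comm]

lemma cE_le_one {p : (V → X) → ℝ} (hp : ∀ x, 0 ≤ p x) (S : Finset V) (f : (V → X) → ℝ)
    (hf : ∀ x, f x ≤ 1) (x : V → X) : cE p S f x ≤ 1 := by
  refine div_le_one_of_le₀ ?_ (mass_nonneg hp S x)
  refine Finset.sum_le_sum fun z _ => mul_le_mul_of_nonneg_left ?_ (agr_nonneg _ _ _)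
  simpa using mul_le_mul_of_nonneg_left (hf z) (hp z)

lemma cE_eq_one {p : (V → X) → ℝ} (hp : ∀ x, 0 ≤ p x) (S : Finset V) (f : (V → X) → ℝ)
    (hf : ∀ x, 0 < p x → f x = 1) {x : V → X} (hx : 0 < mass p S x) : cE p S f x = 1 := by
  have : ∀ z, agr S x z * (p z * f z) = agr S x z * p z := by
    intro z
    rcases (hp z).eq_or_lt with h0 | h0
    · simp [← h0]
    · rw [hf z h0, mul_one]
  simp only [cE, this]
  exact div_self hx.ne'

lemma cE_tower {p : (V → X) → ℝ} (hp : ∀ x, 0 ≤ p x) {S S' : Finset V} (hS : S ⊆ S')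
    (f : (V → X) → ℝ) (x : V → X) : cE p S (cE p S' f) x = cE p S f x := by
  have hd : Dep S' (agr S x) := by
    intro y y' h
    rw [agr_comm, agr_comm S x y']
    exact agr_congr (fun u hu => h u (hS hu)) x
  have := sum_cE hp S' f (agr S x) hd
  unfold cE at this ⊢
  congr 1
  convert this using 2 <;> ring

lemma one_nonneg (u : V) (a : X) (x : V → X) : 0 ≤ one u a x := by
  unfold one; split_ifs <;> norm_num

lemma one_le (u : V) (a : X) (x : V → X) : one u a x ≤ 1 := by
  unfold one; split_ifs <;> norm_num

lemma sum_one (u : V) (x : V → X) : ∑ a, one u a x = 1 := by simp [one]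

/-- Potential. -/
def pot (p : (V → X) → ℝ) (S : Finset V) (u : V) : ℝ :=
  ∑ a, ∑ x, p x * (cE p S (one u a) x) ^ 2

lemma pot_nonneg {p : (V → X) → ℝ} (hp : ∀ x, 0 ≤ p x) (S : Finset V) (u : V) : 0 ≤ pot p S u :=
  Finset.sum_nonneg fun _ _ => Finset.sum_nonneg fun x _ => mul_nonneg (hp x) (sq_nonneg _)

lemma pot_le_one {p : (V → X) → ℝ} (hp : ∀ x, 0 ≤ p x) (h1 : ∑ x, p x = 1) (S : Finset V) (u : V) :
    pot p S u ≤ 1 := by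
  have : pot p S u ≤ ∑ a, ∑ x, p x * cE p S (one u a) x := by
    refine Finset.sum_le_sum fun a _ => Finset.sum_le_sum fun x _ =>
      mul_le_mul_of_nonneg_left ?_ (hp x)
    have h0 := cE_nonneg hp S (one u a) (one_nonneg u a) x
    have h1 := cE_le_one hp S (one u a) (one_le u a) x
    nlinarith
  refine this.trans ?_
  rw [Finset.sum_comm, ← h1]
  refine Finset.sum_le_sum fun x _ => ?_
  rw [← Finset.mul_sum, cE_sum]
  have := cE_le_one hp S (fun z => ∑ a, one u a z) (fun z => (sum_one u z).le) x
  simpa using mul_le_mul_of_nonneg_left this (hp x)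

lemma pyth {p : (V → X) → ℝ} (hp : ∀ x, 0 ≤ p x) {S W : Finset V} (hS : S ⊆ W)
    (f : (V → X) → ℝ) :
    ∑ x, p x * (cE p W f x - cE p S f x) ^ 2 =
      ∑ x, p x * (cE p W f x) ^ 2 - ∑ x, p x * (cE p S f x) ^ 2 := by
  have hd : Dep W (cE p S f) := fun x x' h => cE_congr p f fun u hu => h u (hS hu)
  have h1 := sum_cE hp W f (cE p S f) hd
  have h2 := sum_cE hp S f (cE p S f) (cE_dep p S f)
  have h3 : ∑ x, p x * (cE p W f x - cE p S f x) ^ 2 = ∑ x, p x * (cE p W f x) ^ 2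
      - 2 * ∑ x, p x * cE p W f x * cE p S f x + ∑ x, p x * cE p S f x * cE p S f x := by
    rw [Finset.mul_sum, ← Finset.sum_sub_distrib, ← Finset.sum_add_distrib]
    exact Finset.sum_congr rfl fun x _ => by ring
  have h4 : ∑ x, p x * (cE p S f x) ^ 2 = ∑ x, p x * cE p S f x * cE p S f x :=
    Finset.sum_congr rfl fun x _ => by ring
  rw [h3, h4, h1, h2]; ring

lemma pot_sub {p : (V → X) → ℝ} (hp : ∀ x, 0 ≤ p x) {S W : Finset V} (hS : S ⊆ W) (u : V) :
    ∑ x, p x * ∑ a, (cE p W (one u a) x - cE p S (one u a) x) ^ 2 = pot p W u - pot p S u := by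
  simp only [Finset.mul_sum]
  rw [Finset.sum_comm]
  simp only [pyth hp hS, Finset.sum_sub_distrib, pot]

lemma pot_mono {p : (V → X) → ℝ} (hp : ∀ x, 0 ≤ p x) {S W : Finset V} (hS : S ⊆ W) (u : V) :
    0 ≤ pot p W u - pot p S u := by
  rw [← pot_sub hp hS u]
  exact Finset.sum_nonneg fun x _ => mul_nonneg (hp x) (Finset.sum_nonneg fun a _ => sq_nonneg _)

lemma step {p : (V → X) → ℝ} (hp : ∀ x, 0 ≤ p x) (h1 : ∑ x, p x = 1) {S W : Finset V}
    (hS : S ⊆ W) (u : V) (hu : u ∉ W) (g : (V → X) → ℝ) (hg : Dep (insert u W) g) (B η : ℝ)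
    (hη : 0 < η) (hB : ∀ x, |g x| ≤ B) :
    ∑ x, p x * ∑ a, cE p S (one u a) x * g (Function.update x u a) - ∑ x, p x * g x ≤
      B * (η * (pot p W u - pot p S u) + Fintype.card X / η) := by
  have e1 : ∑ x, p x * g x = ∑ x, p x * ∑ a, cE p W (one u a) x * g (Function.update x u a) := by
    have h : ∀ x, p x * g x = ∑ a, p x * one u a x * g (Function.update x u a) := by
      intro x
      have : ∀ a, p x * one u a x * g (Function.update x u a) = if x u = a then p x * g x else 0 := by
        intro a
        unfold one
        split_ifs with h
        · subst h; simp
        · simp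
      simp [this]
    simp only [h, Finset.mul_sum]
    rw [Finset.sum_comm]
    conv_rhs => rw [Finset.sum_comm]
    refine Finset.sum_congr rfl fun a _ => ?_
    rw [← sum_cE hp W (one u a) (fun x => g (Function.update x u a))]
    · exact Finset.sum_congr rfl fun x _ => by ring
    · intro x x' h
      apply hg
      intro v hv
      by_cases hvu : v = u
      · subst hvu; simp
      · simp [hvu, h v ((Finset.mem_insert.1 hv).resolve_left hvu)]
  rw [e1, ← pot_sub hp hS u, ← Finset.sum_sub_distrib]
  have e2 : B * (η * ∑ x, p x * ∑ a, (cE p W (one u a) x - cE p S (one u a) x) ^ 2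
      + Fintype.card X / η) =
      ∑ x, p x * ∑ a, B * (η * (cE p W (one u a) x - cE p S (one u a) x) ^ 2 + 1 / η) := by
    simp only [← Finset.mul_sum, Finset.sum_add_distrib, Finset.sum_const, Finset.card_univ,
      nsmul_eq_mul, mul_add]
    rw [← Finset.sum_mul, h1, Finset.mul_sum, Finset.mul_sum, one_mul]
    congr 1
    · exact Finset.sum_congr rfl fun x _ => by ring
    · ring
  rw [e2]
  refine Finset.sum_le_sum fun x _ => ?_
  rw [← mul_sub, ← Finset.sum_sub_distrib]
  refine mul_le_mul_of_nonneg_left (Finset.sum_le_sum fun a _ => ?_) (hp x)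
  set t := cE p W (one u a) x - cE p S (one u a) x with ht
  have hB0 : 0 ≤ B := (abs_nonneg _).trans (hB x)
  have h3 : |t| ≤ η * t ^ 2 + 1 / η := by
    have h4 : η * |t| ≤ (η * |t|) ^ 2 + 1 := by nlinarith [sq_nonneg (η * |t| - 1)]
    have h5 : η * t ^ 2 + 1 / η = ((η * |t|) ^ 2 + 1) / η := by
      rw [mul_pow, sq_abs]; field_simp
    rw [h5, le_div_iff₀ hη]; linarith
  calc _ = (-t) * g (Function.update x u a) := by rw [ht]; ring
    _ ≤ |(-t) * g (Function.update x u a)| := le_abs_self _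
    _ = |t| * |g (Function.update x u a)| := by rw [abs_mul, abs_neg]
    _ ≤ |t| * B := mul_le_mul_of_nonneg_left (hB _) (abs_nonneg _)
    _ ≤ (η * t ^ 2 + 1 / η) * B := mul_le_mul_of_nonneg_right h3 hB0
    _ = _ := by ring

lemma sum_prod_one {Z : Type*} [Fintype Z] (w : V → Z → ℝ) (hw : ∀ v, ∑ a, w v a = 1) :
    ∑ y : V → Z, ∏ v, w v (y v) = 1 := by
  have := Finset.prod_univ_sum (fun _ : V => (Finset.univ : Finset Z)) w
  rw [Fintype.piFinset_univ] at this
  rw [← this]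
  simp [hw]

/-- Resampling one coordinate. -/
lemma resample (w : V → X → ℝ) (u : V) (hw : ∑ a, w u a = 1) (g : (V → X) → ℝ) :
    ∑ a, w u a * ∑ y, (∏ v, w v (y v)) * g (Function.update y u a) =
      ∑ y, (∏ v, w v (y v)) * g y := by
  have e1 : ∑ y, (∏ v, w v (y v)) * g y =
      ∑ q : X × (V → X), w u q.1 * ((∏ v, w v (q.2 v)) * g q.2) := by
    rw [Fintype.sum_prod_type]
    simp only [← Finset.mul_sum]
    rw [← Finset.sum_mul, hw, one_mul]
  have e2 : ∑ a, w u a * ∑ y, (∏ v, w v (y v)) * g (Function.update y u a) =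
      ∑ q : X × (V → X), w u q.1 * ((∏ v, w v (q.2 v)) * g (Function.update q.2 u q.1)) := by
    rw [Fintype.sum_prod_type]
    simp only [← Finset.mul_sum]
  rw [e1, e2]
  have hinv : Function.Involutive
      (fun q : X × (V → X) => ((q.2 u, Function.update q.2 u q.1) : X × (V → X))) := by
    intro q; ext <;> simp
  refine Fintype.sum_equiv hinv.toPerm _ _ fun q => ?_
  simp only [Function.Involutive.coe_toPerm]
  rw [← mul_assoc, ← mul_assoc]
  congr 1
  rw [← Finset.mul_prod_erase Finset.univ _ (Finset.mem_univ u),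
    ← Finset.mul_prod_erase Finset.univ (fun v => w v (Function.update q.2 u q.1 v))
      (Finset.mem_univ u)]
  have : ∏ v ∈ Finset.univ.erase u, w v (Function.update q.2 u q.1 v) =
      ∏ v ∈ Finset.univ.erase u, w v (q.2 v) :=
    Finset.prod_congr rfl fun v hv => by simp [Finset.ne_of_mem_erase hv]
  rw [this]; simp; ring

/-- Site distribution. -/
def qq (p : (V → X) → ℝ) (S : Finset V) (u : V) (a : X) (x : V → X) : ℝ :=
  cE p S (cE p (Finset.univ.erase u) (one u a)) x

/-- Hybrid expectation. -/
def TT (p : (V → X) → ℝ) (S T : Finset V) (f : (V → X) → ℝ) (x : V → X) : ℝ :=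
  ∑ y, (∏ v, qq p S v (y v) x) * f (T.piecewise y x)

lemma qq_nonneg {p : (V → X) → ℝ} (hp : ∀ x, 0 ≤ p x) (S : Finset V) (u : V) (a : X) (x : V → X) :
    0 ≤ qq p S u a x :=
  cE_nonneg hp _ _ (cE_nonneg hp _ _ (one_nonneg u a)) x

lemma sum_qq_le {p : (V → X) → ℝ} (hp : ∀ x, 0 ≤ p x) (S : Finset V) (u : V) (x : V → X) :
    ∑ a, qq p S u a x ≤ 1 := by
  unfold qq
  rw [cE_sum]
  refine cE_le_one hp _ _ (fun z => ?_) x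
  rw [cE_sum]
  exact cE_le_one hp _ _ (fun z => (sum_one u z).le) _

lemma sum_qq {p : (V → X) → ℝ} (hp : ∀ x, 0 ≤ p x) (S : Finset V) (u : V) (x : V → X)
    (hx : 0 < p x) : ∑ a, qq p S u a x = 1 := by
  unfold qq
  rw [cE_sum]
  refine cE_eq_one hp _ _ (fun z hz => ?_) (mass_pos hp S hx)
  rw [cE_sum]
  exact cE_eq_one hp _ _ (fun z _ => (sum_one u z)) (mass_pos hp _ hz)

lemma qq_congr (p : (V → X) → ℝ) {S : Finset V} (u : V) (a : X) {x x' : V → X}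
    (h : ∀ u ∈ S, x u = x' u) : qq p S u a x = qq p S u a x' := cE_congr p _ h

lemma qq_eq {p : (V → X) → ℝ} (hp : ∀ x, 0 ≤ p x) {S : Finset V} {u : V} (hu : u ∉ S) (a : X)
    (x : V → X) : qq p S u a x = cE p S (one u a) x := by
  refine cE_tower hp (fun v hv => ?_) _ _
  simp only [Finset.mem_erase, Finset.mem_univ, and_true]
  rintro rfl; exact hu hv

lemma TT_abs {p : (V → X) → ℝ} (hp : ∀ x, 0 ≤ p x) (S T : Finset V) (f : (V → X) → ℝ) (B : ℝ)
    (hB0 : 0 ≤ B) (hB : ∀ x, |f x| ≤ B) (x : V → X) : |TT p S T f x| ≤ B := by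
  calc |TT p S T f x| ≤ ∑ y, |(∏ v, qq p S v (y v) x) * f (T.piecewise y x)| :=
        Finset.abs_sum_le_sum_abs _ _
    _ ≤ ∑ y : V → X, (∏ v, qq p S v (y v) x) * B := by
        refine Finset.sum_le_sum fun y _ => ?_
        have := Finset.prod_nonneg (s := Finset.univ) fun v _ => qq_nonneg hp S v (y v) x
        rw [abs_mul, abs_of_nonneg this]
        exact mul_le_mul_of_nonneg_left (hB _) this
    _ = (∏ v, ∑ a, qq p S v a x) * B := by
        rw [← Finset.sum_mul, Finset.prod_univ_sum, Fintype.piFinset_univ]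
    _ ≤ 1 * B := by
        refine mul_le_mul_of_nonneg_right ?_ hB0
        exact Finset.prod_le_one (fun v _ => Finset.sum_nonneg fun a _ => qq_nonneg hp S v a x)
          (fun v _ => sum_qq_le hp S v x)
    _ = B := one_mul B

lemma TT_insert {p : (V → X) → ℝ} (hp : ∀ x, 0 ≤ p x) {S T : Finset V} {u : V} (hS : u ∉ S)
    (hT : u ∉ T) (f : (V → X) → ℝ) (x : V → X) (hx : 0 < p x) :
    TT p S (insert u T) f x = ∑ a, cE p S (one u a) x * TT p S T f (Function.update x u a) := by
  unfold TT
  rw [← resample (fun v a => qq p S v a x) u (sum_qq hp S u x hx)]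
  refine Finset.sum_congr rfl fun a _ => ?_
  rw [qq_eq hp hS]
  congr 1
  refine Finset.sum_congr rfl fun y _ => ?_
  congr 1
  · refine Finset.prod_congr rfl fun v _ => qq_congr p v _ fun w hw => ?_
    have : w ≠ u := by rintro rfl; exact hS hw
    simp [this]
  · congr 1
    ext v
    by_cases hv : v = u
    · subst hv; simp [hT]
    · by_cases hvT : v ∈ T <;> simp [Finset.piecewise, hv, hvT]

lemma TT_dep (p : (V → X) → ℝ) (S T e : Finset V) (f : (V → X) → ℝ) (hf : Dep e f) :
    Dep (S ∪ e) (TT p S T f) := by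
  intro x x' h
  unfold TT
  refine Finset.sum_congr rfl fun y _ => ?_
  congr 1
  · exact Finset.prod_congr rfl fun v _ => qq_congr p v _ fun w hw =>
      h w (Finset.mem_union_left _ hw)
  · apply hf
    intro v hv
    by_cases hvT : v ∈ T <;> simp [Finset.piecewise, hvT, h v (Finset.mem_union_right _ hv)]

lemma edge {p : (V → X) → ℝ} (hp : ∀ x, 0 ≤ p x) (h1 : ∑ x, p x = 1) {S e : Finset V}
    (hSe : Disjoint S e) (f : (V → X) → ℝ) (hf : Dep e f) (B η : ℝ) (hη : 0 < η) (hB0 : 0 ≤ B)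
    (hB : ∀ x, |f x| ≤ B) :
    ∑ x, p x * TT p S Finset.univ f x - ∑ x, p x * f x ≤
      B * ∑ u ∈ e, (η * (pot p (S ∪ e.erase u) u - pot p S u) + Fintype.card X / η) := by
  have key : ∀ T : Finset V, T ⊆ e → ∑ x, p x * TT p S T f x - ∑ x, p x * f x ≤
      B * ∑ u ∈ T, (η * (pot p (S ∪ e.erase u) u - pot p S u) + Fintype.card X / η) := by
    intro T
    induction T using Finset.induction_on with
    | empty =>
      intro _
      have : ∀ x, p x * TT p S ∅ f x = p x * f x := by
        intro x
        rcases (hp x).eq_or_lt with h0 | h0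
        · simp [← h0]
        · unfold TT
          have e : ∑ y : V → X, ∏ v, qq p S v (y v) x = 1 := by
            exact sum_prod_one (fun v a => qq p S v a x) fun v => sum_qq hp S v x h0
          simp only [Finset.piecewise_empty, ← Finset.sum_mul, e, one_mul]
      simp [this]
    | insert u T hu ih =>
      intro hT
      have hue : u ∈ e := hT (Finset.mem_insert_self _ _)
      have huS : u ∉ S := fun h => Finset.disjoint_left.1 hSe h hue
      have ih' := ih ((Finset.subset_insert _ _).trans hT)
      rw [Finset.sum_insert hu]
      have hst := step hp h1 (S := S) (W := S ∪ e.erase u) Finset.subset_union_left u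
        (by simp [huS]) (TT p S T f)
        (by
          have : insert u (S ∪ e.erase u) = S ∪ e := by
            rw [← Finset.union_insert, Finset.insert_erase hue]
          rw [this]
          exact TT_dep p S T e f hf) B η hη (TT_abs hp S T f B hB0 hB)
      have e : ∑ x, p x * TT p S (insert u T) f x =
          ∑ x, p x * ∑ a, cE p S (one u a) x * TT p S T f (Function.update x u a) := by
        refine Finset.sum_congr rfl fun x _ => ?_
        rcases (hp x).eq_or_lt with h0 | h0
        · simp [← h0]
        · rw [TT_insert hp huS hu f x h0]
      rw [e]
      linarith
  have := key e subset_rfl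
  have e2 : ∀ x, TT p S Finset.univ f x = TT p S e f x := by
    intro x
    unfold TT
    refine Finset.sum_congr rfl fun y _ => ?_
    congr 1
    apply hf
    intro v hv
    simp [Finset.piecewise, hv]
  simpa only [e2] using this

lemma edge' {p : (V → X) → ℝ} (hp : ∀ x, 0 ≤ p x) (h1 : ∑ x, p x = 1) (S : Finset V)
    (f : (V → X) → ℝ) (B : ℝ) (hB0 : 0 ≤ B) (hB : ∀ x, |f x| ≤ B) :
    ∑ x, p x * TT p S Finset.univ f x - ∑ x, p x * f x ≤ 2 * B := by
  rw [← Finset.sum_sub_distrib]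
  calc _ ≤ ∑ x, p x * (2 * B) := by
        refine Finset.sum_le_sum fun x _ => ?_
        rw [← mul_sub]
        refine mul_le_mul_of_nonneg_left ?_ (hp x)
        have := abs_le.1 (TT_abs hp S Finset.univ f B hB0 hB x)
        have := abs_le.1 (hB x)
        linarith
    _ = 2 * B := by rw [← Finset.sum_mul, h1, one_mul]

lemma exists_avg {ι : Type*} [Fintype ι] (w G : ι → ℝ) (t : ℝ) (hw : ∀ i, 0 ≤ w i)
    (h1 : ∑ i, w i = 1) (h : ∑ i, w i * G i ≤ t) : ∃ i, 0 < w i ∧ G i ≤ t := by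
  by_contra! hc
  have h2 : ∑ i, w i * t < ∑ i, w i * G i := by
    have hpos : ∃ i, 0 < w i := by
      by_contra! hn
      have : ∑ i, w i ≤ 0 := Finset.sum_nonpos fun i _ => hn i
      linarith
    obtain ⟨i, hi⟩ := hpos
    refine Finset.sum_lt_sum (fun j _ => ?_) ⟨i, Finset.mem_univ _, ?_⟩
    · rcases (hw j).eq_or_lt with h0 | h0
      · simp [← h0]
      · exact mul_le_mul_of_nonneg_left (hc j h0).le (hw j)
    · exact mul_lt_mul_of_pos_left (hc i hi) hi
  rw [← Finset.sum_mul, h1, one_mul] at h2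
  linarith

/-- Degree of a vertex. -/
def deg (E : Finset (Finset V)) (v : V) : ℝ := ((E.filter (fun e => v ∈ e)).card : ℝ)

lemma deg_nonneg (E : Finset (Finset V)) (v : V) : 0 ≤ deg E v := Nat.cast_nonneg _

lemma touch_le (E : Finset (Finset V)) (S : Finset V) :
    ((E.filter (fun e => ¬ Disjoint S e)).card : ℝ) ≤ ∑ v ∈ S, deg E v := by
  have h1 : E.filter (fun e => ¬ Disjoint S e) ⊆ S.biUnion fun v => E.filter (fun e => v ∈ e) := by
    intro e he
    simp only [Finset.mem_filter, Finset.not_disjoint_iff] at he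
    obtain ⟨h, v, hv, hve⟩ := he
    simp only [Finset.mem_biUnion, Finset.mem_filter]
    exact ⟨v, hv, h, hve⟩
  have := (Finset.card_le_card h1).trans Finset.card_biUnion_le
  unfold deg
  exact_mod_cast this

lemma sum_deg (E : Finset (Finset V)) (k : ℕ) (hE : ∀ e ∈ E, e.card = k) :
    ∑ v, deg E v = k * E.card := by
  have : ∀ v, deg E v = ∑ e ∈ E, if v ∈ e then (1 : ℝ) else 0 := by
    intro v; simp [deg]
  simp only [this]
  rw [Finset.sum_comm]
  have : ∀ e ∈ E, ∑ v, (if v ∈ e then (1 : ℝ) else 0) = k := by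
    intro e he; simp [hE e he]
  rw [Finset.sum_congr rfl this]; simp [mul_comm]

lemma count_T (k : ℕ) (v : V) :
    Fintype.card V * ((Finset.powersetCard (k - 1) (Finset.univ : Finset V)).filter
      (fun T => v ∈ T)).card ≤ Fintype.card V ^ (k - 1) := by
  rcases hk : k - 1 with _ | j
  · simp [Finset.filter_singleton]
  · rw [pow_succ']
    refine Nat.mul_le_mul_left _ ?_
    have : ((Finset.powersetCard (j + 1) (Finset.univ : Finset V)).filter
      (fun T => v ∈ T)).card ≤ (Finset.powersetCard j (Finset.univ : Finset V)).card := by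
      refine Finset.card_le_card_of_injOn (fun T => T.erase v) ?_ ?_
      · intro T hT
        simp only [Finset.coe_filter, Finset.mem_powersetCard, Set.mem_ofPred_eq] at hT
        simp [Finset.card_erase_of_mem hT.2, hT.1.2]
      · intro T hT T' hT' h
        simp only [Finset.coe_filter, Finset.mem_powersetCard, Set.mem_ofPred_eq] at hT hT'
        simp only at h
        rw [← Finset.insert_erase hT.2, h, Finset.insert_erase hT'.2]
    refine this.trans ?_
    rw [Finset.card_powersetCard, Finset.card_univ]
    exact Nat.choose_le_pow _ _

lemma choose_S {p : (V → X) → ℝ} (hp : ∀ x, 0 ≤ p x) (h1 : ∑ x, p x = 1)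
    (E : Finset (Finset V)) (k : ℕ) (hE : ∀ e ∈ E, e.card = k) (lam : ℝ) (hl : 0 < lam) :
    ∃ S : Finset V, lam * ∑ v ∈ S, deg E v ≤ Fintype.card V ∧
      Fintype.card V * ∑ e ∈ E, ∑ u ∈ e, (pot p (S ∪ e.erase u) u - pot p S u) ≤
        lam * (k * E.card * (Fintype.card V : ℝ) ^ (k - 1)) := by
  obtain ⟨S, -, hS⟩ := Finset.exists_max_image (Finset.univ : Finset (Finset V))
    (fun S => ∑ u, pot p S u - lam * ∑ v ∈ S, deg E v) Finset.univ_nonempty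
  refine ⟨S, ?_, ?_⟩
  · have h := hS ∅ (Finset.mem_univ _)
    simp only [Finset.sum_empty, mul_zero, sub_zero] at h
    have h2 : 0 ≤ ∑ u, pot p ∅ u := Finset.sum_nonneg fun u _ => pot_nonneg hp _ u
    have h3 : ∑ u, pot p S u ≤ ∑ u : V, (1 : ℝ) :=
      Finset.sum_le_sum fun u _ => pot_le_one hp h1 S u
    simp at h3
    linarith
  · have hgain : ∀ T : Finset V, ∑ u, (pot p (S ∪ T) u - pot p S u) ≤ lam * ∑ v ∈ T, deg E v := by
      intro T
      have h := hS (S ∪ T) (Finset.mem_univ _)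
      have h2 : ∑ v ∈ S ∪ T, deg E v ≤ ∑ v ∈ S, deg E v + ∑ v ∈ T, deg E v := by
        rw [← Finset.sum_union_inter]
        have : 0 ≤ ∑ v ∈ S ∩ T, deg E v := Finset.sum_nonneg fun v _ => deg_nonneg E v
        linarith
      have h3 := mul_le_mul_of_nonneg_left h2 hl.le
      rw [Finset.sum_sub_distrib]
      linarith
    have hsum : ∑ e ∈ E, ∑ u ∈ e, (pot p (S ∪ e.erase u) u - pot p S u) ≤
        ∑ T ∈ Finset.powersetCard (k - 1) Finset.univ, ∑ u, (pot p (S ∪ T) u - pot p S u) := by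
      rw [Finset.sum_sigma', Finset.sum_sigma']
      let φ : (_ : Finset V) × V → (_ : Finset V) × V := fun q => ⟨q.1.erase q.2, q.2⟩
      have hinj : Set.InjOn φ (E.sigma fun e => e : Finset ((_ : Finset V) × V)) := by
        rintro ⟨e, u⟩ h ⟨e', u'⟩ h' hh
        simp only [Finset.mem_coe, Finset.mem_sigma] at h h'
        simp only [φ, Sigma.mk.injEq, heq_eq_eq] at hh
        obtain ⟨h1, rfl⟩ := hh
        have : e = e' := by
          rw [← Finset.insert_erase h.2, h1, Finset.insert_erase h'.2]
        subst this; rfl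
      rw [← Finset.sum_image (s := E.sigma fun e => e) (g := φ)
        (f := fun q => pot p (S ∪ q.1) q.2 - pot p S q.2) hinj]
      refine Finset.sum_le_sum_of_subset_of_nonneg ?_ fun q _ _ =>
        pot_mono hp Finset.subset_union_left _
      rintro ⟨T, u⟩ hq
      simp only [Finset.mem_image, Finset.mem_sigma, φ] at hq
      obtain ⟨⟨e, u'⟩, ⟨he, hu⟩, hq⟩ := hq
      simp only [Sigma.mk.injEq, heq_eq_eq] at hq
      obtain ⟨rfl, rfl⟩ := hq
      simp only at hu he
      simp [Finset.card_erase_of_mem hu, hE e he]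
    have hT : Fintype.card V * ∑ T ∈ Finset.powersetCard (k - 1) Finset.univ, ∑ v ∈ T, deg E v ≤
        k * E.card * (Fintype.card V : ℝ) ^ (k - 1) := by
      have e1 : ∑ T ∈ Finset.powersetCard (k - 1) Finset.univ, ∑ v ∈ T, deg E v =
          ∑ v, deg E v * (((Finset.powersetCard (k - 1) (Finset.univ : Finset V)).filter
            (fun T => v ∈ T)).card : ℝ) := by
        have : ∀ T : Finset V, ∑ v ∈ T, deg E v = ∑ v, if v ∈ T then deg E v else 0 := by
          intro T; simp
        simp only [this]
        rw [Finset.sum_comm]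
        refine Finset.sum_congr rfl fun v _ => ?_
        rw [← Finset.sum_filter]; simp [mul_comm]
      rw [e1, Finset.mul_sum, ← sum_deg E k hE, Finset.sum_mul]
      refine Finset.sum_le_sum fun v _ => ?_
      have := count_T k v
      have h' : (Fintype.card V : ℝ) * (((Finset.powersetCard (k - 1)
        (Finset.univ : Finset V)).filter (fun T => v ∈ T)).card : ℝ)
          ≤ (Fintype.card V : ℝ) ^ (k - 1) := by exact_mod_cast this
      calc _ = deg E v * ((Fintype.card V : ℝ) * (((Finset.powersetCard (k - 1)
        (Finset.univ : Finset V)).filter (fun T => v ∈ T)).card : ℝ)) := by ring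
        _ ≤ _ := mul_le_mul_of_nonneg_left h' (deg_nonneg E v)
    calc _ ≤ Fintype.card V * ∑ T ∈ Finset.powersetCard (k - 1) Finset.univ,
            lam * ∑ v ∈ T, deg E v :=
          mul_le_mul_of_nonneg_left (hsum.trans (Finset.sum_le_sum fun T _ => hgain T))
            (Nat.cast_nonneg _)
      _ = lam * (Fintype.card V * ∑ T ∈ Finset.powersetCard (k - 1) Finset.univ,
            ∑ v ∈ T, deg E v) := by rw [← Finset.mul_sum]; ring
      _ ≤ _ := mul_le_mul_of_nonneg_left hT hl.le

lemma classical_main {p : (V → X) → ℝ} (hp : ∀ x, 0 ≤ p x) (h1 : ∑ x, p x = 1)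
    (E : Finset (Finset V)) (k : ℕ) (hE : ∀ e ∈ E, e.card = k)
    (c : Finset V → (V → X) → ℝ) (B : ℝ) (hB0 : 0 ≤ B) (hB : ∀ e ∈ E, ∀ x, |c e x| ≤ B)
    (hc : ∀ e ∈ E, Dep e (c e)) (Y : ℝ) (hY : 0 < Y)
    (hY3 : Y ^ 3 = (E.card : ℝ) ^ 2 * (Fintype.card V : ℝ) ^ (k - 1))
    (hm : 0 < E.card) (hn : 0 < Fintype.card V) :
    ∃ z : V → (V → X), (∀ u, 0 < p (z u)) ∧
      ∑ y : V → X, (∏ u, cE p (Finset.univ.erase u) (one u (y u)) (z u)) * ∑ e ∈ E, c e y ≤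
        ∑ x, p x * ∑ e ∈ E, c e x + B * (2 + k + k * Fintype.card X) * Y := by
  have hm' : (0 : ℝ) < E.card := by exact_mod_cast hm
  have hn' : (0 : ℝ) < Fintype.card V := by exact_mod_cast hn
  set n : ℝ := (Fintype.card V : ℝ) with hndef
  set m : ℝ := (E.card : ℝ) with hmdef
  set D : ℝ := (Fintype.card X : ℝ) with hDdef
  obtain ⟨S, hS1, hS2⟩ := choose_S hp h1 E k hE (n / Y) (by positivity)
  have hη : 0 < m / Y := by positivity
  set δ : ℝ := ∑ e ∈ E, ∑ u ∈ e, (pot p (S ∪ e.erase u) u - pot p S u) with hδ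
  have hcost : ∑ v ∈ S, deg E v ≤ Y := by
    have h : n / Y * ∑ v ∈ S, deg E v = (n * ∑ v ∈ S, deg E v) / Y := by ring
    rw [h, div_le_iff₀ hY] at hS1
    exact le_of_mul_le_mul_left hS1 hn'
  have hδ2 : m / Y * δ ≤ k * Y := by
    have h2 : δ ≤ (k * m * n ^ (k - 1)) / Y := by
      rw [le_div_iff₀ hY]
      have : n / Y * (k * m * n ^ (k - 1)) = n * (k * m * n ^ (k - 1)) / Y := by ring
      rw [this, le_div_iff₀ hY] at hS2
      refine le_of_mul_le_mul_left ?_ hn'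
      linarith
    calc m / Y * δ ≤ m / Y * ((k * m * n ^ (k - 1)) / Y) := mul_le_mul_of_nonneg_left h2 hη.le
      _ = k * (m ^ 2 * n ^ (k - 1)) / Y ^ 2 := by field_simp
      _ = k * Y := by rw [← hY3]; field_simp
  have hper : ∀ e ∈ E, ∑ x, p x * TT p S Finset.univ (c e) x - ∑ x, p x * c e x ≤
      B * ∑ u ∈ e, (m / Y * (pot p (S ∪ e.erase u) u - pot p S u) + D / (m / Y)) +
        2 * B * (if ¬ Disjoint S e then 1 else 0) := by
    intro e he
    by_cases hd : Disjoint S e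
    · simpa [hd] using edge hp h1 hd (c e) (hc e he) B (m / Y) hη hB0 (hB e he)
    · have h := edge' hp h1 S (c e) B hB0 (hB e he)
      have h2 : 0 ≤ B * ∑ u ∈ e, (m / Y * (pot p (S ∪ e.erase u) u - pot p S u) + D / (m / Y)) := by
        refine mul_nonneg hB0 (Finset.sum_nonneg fun u _ => ?_)
        have := pot_mono hp (S := S) (W := S ∪ e.erase u) Finset.subset_union_left u
        positivity
      simp [hd]
      linarith
  have htot := Finset.sum_le_sum hper
  rw [Finset.sum_add_distrib, ← Finset.mul_sum, ← Finset.mul_sum, Finset.sum_boole,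
    Finset.sum_sub_distrib] at htot
  have e1 : ∑ e ∈ E, ∑ u ∈ e, (m / Y * (pot p (S ∪ e.erase u) u - pot p S u) + D / (m / Y)) =
      m / Y * δ + k * D * Y := by
    simp only [Finset.sum_add_distrib, ← Finset.mul_sum, Finset.sum_const, nsmul_eq_mul]
    congr 1
    rw [← Finset.sum_mul, Finset.sum_congr rfl fun e he => by rw [hE e he]]
    simp only [Finset.sum_const, nsmul_eq_mul]
    rw [← hmdef]
    field_simp
  rw [e1] at htot
  have htouch := touch_le E S
  have hfin : ∑ x, p x * (∑ y : V → X, (∏ v, qq p S v (y v) x) * ∑ e ∈ E, c e y) ≤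
      ∑ x, p x * ∑ e ∈ E, c e x + B * (2 + k + k * D) * Y := by
    have a1 : ∑ e ∈ E, ∑ x, p x * TT p S Finset.univ (c e) x =
        ∑ x, p x * (∑ y : V → X, (∏ v, qq p S v (y v) x) * ∑ e ∈ E, c e y) := by
      rw [Finset.sum_comm]
      refine Finset.sum_congr rfl fun x _ => ?_
      rw [← Finset.mul_sum]
      congr 1
      unfold TT
      rw [Finset.sum_comm]
      refine Finset.sum_congr rfl fun y _ => ?_
      rw [← Finset.mul_sum]
      simp
    have a2 : ∑ e ∈ E, ∑ x, p x * c e x = ∑ x, p x * ∑ e ∈ E, c e x := by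
      rw [Finset.sum_comm]
      exact Finset.sum_congr rfl fun x _ => by rw [Finset.mul_sum]
    rw [a1, a2] at htot
    have b1 : B * (m / Y * δ + k * D * Y) ≤ B * (k * Y + k * D * Y) :=
      mul_le_mul_of_nonneg_left (by linarith) hB0
    have b2 := mul_le_mul_of_nonneg_left (htouch.trans hcost) (by positivity : 0 ≤ 2 * B)
    linarith
  obtain ⟨x, hx, hxle⟩ := exists_avg p _ _ hp h1 hfin
  have hmx := mass_pos hp S hx
  -- second averaging
  let μ : (V → X) → ℝ := fun z => agr S x z * p z / mass p S x
  have hμ0 : ∀ z, 0 ≤ μ z := fun z =>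
    div_nonneg (mul_nonneg (agr_nonneg _ _ _) (hp z)) hmx.le
  have hμ1 : ∑ z, μ z = 1 := by
    simp only [μ, ← Finset.sum_div]
    exact div_self hmx.ne'
  have hq : ∀ u a, qq p S u a x = ∑ z, μ z * cE p (Finset.univ.erase u) (one u a) z := by
    intro u a
    conv_lhs => unfold qq cE
    rw [Finset.sum_div]
    exact Finset.sum_congr rfl fun z _ => by simp only [μ, cE]; ring
  have hE2 : ∑ y : V → X, (∏ v, qq p S v (y v) x) * ∑ e ∈ E, c e y =
      ∑ z : V → (V → X), (∏ u, μ (z u)) *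
        ∑ y : V → X, (∏ u, cE p (Finset.univ.erase u) (one u (y u)) (z u)) * ∑ e ∈ E, c e y := by
    simp only [hq, Finset.prod_univ_sum, Fintype.piFinset_univ, Finset.prod_mul_distrib]
    simp only [Finset.mul_sum (Finset.univ : Finset (V → X)), Finset.sum_mul (Finset.univ)]
    rw [Finset.sum_comm]
    exact Finset.sum_congr rfl fun z _ => Finset.sum_congr rfl fun y _ => by ring
  rw [hE2] at hxle
  obtain ⟨z, hz, hzle⟩ := exists_avg (fun z : V → (V → X) => ∏ u, μ (z u)) _ _
    (fun z => Finset.prod_nonneg fun u _ => hμ0 _)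
    (sum_prod_one (fun _ => μ) fun _ => hμ1) hxle
  refine ⟨z, fun u => ?_, hzle⟩
  refine (hp _).lt_of_ne fun h0 => ?_
  have : μ (z u) = 0 := by simp [μ, ← h0]
  exact hz.ne' (Finset.prod_eq_zero (Finset.mem_univ u) this)

end Classical

/-! ### Quantum part -/

section Quantum

open Complex

/-- Outcomes of the informationally complete measurement. -/
abbrev Out (d : ℕ) : Type := Fin d × Fin d × Fin 4

/-- Vectors of the rank one measurement. -/
def wv {d : ℕ} (x : Out d) (a : Fin d) : ℂ :=
  ((Real.sqrt (8 * d))⁻¹ : ℝ) *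
    ((if a = x.1 then 1 else 0) + I ^ (x.2.2 : ℕ) * (if a = x.2.1 then 1 else 0))

lemma scal {d : ℕ} (hd : 0 < d) :
    (((Real.sqrt (8 * d))⁻¹ : ℝ) : ℂ) * (((Real.sqrt (8 * d))⁻¹ : ℝ) : ℂ) = 1 / (8 * d) := by
  rw [← ofReal_mul, ← mul_inv, Real.mul_self_sqrt (by positivity)]
  push_cast
  simp

lemma wv_mul {d : ℕ} (hd : 0 < d) (x : Out d) (a b : Fin d) :
    wv x a * (starRingEnd ℂ) (wv x b) = 1 / (8 * d) *
      (((if a = x.1 then 1 else 0) + I ^ (x.2.2 : ℕ) * (if a = x.2.1 then 1 else 0)) *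
      ((if b = x.1 then 1 else 0) + (-I) ^ (x.2.2 : ℕ) * (if b = x.2.1 then 1 else 0))) := by
  rw [← scal hd]
  unfold wv
  simp only [map_mul, map_add, conj_ofReal, map_pow, conj_I, apply_ite (starRingEnd ℂ), map_one,
    map_zero]
  ring

lemma site1 {d : ℕ} (hd : 0 < d) (α β a b : Fin d) :
    ∑ j : Fin 4, (2 * d * I ^ (j : ℕ)) * (wv (α, β, j) a * (starRingEnd ℂ) (wv (α, β, j) b)) =
      if a = α ∧ b = β then 1 else 0 := by
  have hd' : (d : ℂ) ≠ 0 := by exact_mod_cast hd.ne'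
  have hI2 : I ^ 2 = -1 := I_sq
  have hI3 : I ^ 3 = -I := I_pow_three
  simp only [wv_mul hd, Fin.sum_univ_four]
  have h3 : ((3 : Fin 4) : ℕ) = 3 := rfl
  have h2 : ((2 : Fin 4) : ℕ) = 2 := rfl
  simp only [Fin.val_zero, Fin.val_one, h2, h3, pow_zero, pow_one, neg_pow I 2, neg_pow I 3, hI2,
    hI3]
  generalize hA1 : (if a = α then (1 : ℂ) else 0) = A1
  generalize hA2 : (if a = β then (1 : ℂ) else 0) = A2
  generalize hB1 : (if b = α then (1 : ℂ) else 0) = B1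
  generalize hB2 : (if b = β then (1 : ℂ) else 0) = B2
  have : (if a = α ∧ b = β then (1 : ℂ) else 0) = A1 * B2 := by
    rw [← hA1, ← hB2, ite_and]; split_ifs <;> simp
  rw [this]
  field_simp
  ring_nf
  simp only [show I ^ 4 = 1 from I_pow_four, hI2, hI3]
  ring

lemma site2 {d : ℕ} (hd : 0 < d) (a b : Fin d) :
    ∑ x : Out d, wv x a * (starRingEnd ℂ) (wv x b) = if a = b then 1 else 0 := by
  have hd' : (d : ℂ) ≠ 0 := by exact_mod_cast hd.ne'
  have hI2 : I ^ 2 = -1 := I_sq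
  have hI3 : I ^ 3 = -I := I_pow_three
  have h3 : ((3 : Fin 4) : ℕ) = 3 := rfl
  have h2 : ((2 : Fin 4) : ℕ) = 2 := rfl
  have key : ∀ α β : Fin d, ∑ j : Fin 4, wv (α, β, j) a * (starRingEnd ℂ) (wv (α, β, j) b) =
      1 / (2 * d) * ((if a = α then (if b = α then 1 else 0) else 0) +
        (if a = β then (if b = β then 1 else 0) else 0)) := by
    intro α β
    simp only [wv_mul hd, Fin.sum_univ_four]
    simp only [Fin.val_zero, Fin.val_one, h2, h3, pow_zero, pow_one, neg_pow I 2, neg_pow I 3, hI2,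
      hI3]
    have e1 : ∀ γ : Fin d, (if a = γ then (if b = γ then (1 : ℂ) else 0) else 0) =
      (if a = γ then 1 else 0) * (if b = γ then 1 else 0) := by
      intro γ; split_ifs <;> simp
    rw [e1, e1]
    generalize (if a = α then (1 : ℂ) else 0) = A1
    generalize (if a = β then (1 : ℂ) else 0) = A2
    generalize (if b = α then (1 : ℂ) else 0) = B1
    generalize (if b = β then (1 : ℂ) else 0) = B2
    field_simp
    ring_nf
    simp only [show I ^ 4 = 1 from I_pow_four, hI2, hI3]
    ring
  simp only [Fintype.sum_prod_type, key]
  simp only [← Finset.mul_sum, Finset.sum_add_distrib, Finset.sum_ite_eq, Finset.mem_univ, if_true,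
    Finset.sum_const, Finset.card_univ, Fintype.card_fin, nsmul_eq_mul]
  simp only [eq_comm (a := b)]
  split_ifs
  · field_simp; ring
  · simp

variable {n d : ℕ}

/-- Measurement amplitude. -/
def amp (φ : (Fin n → Fin d) → ℂ) (x : Fin n → Out d) : ℂ :=
  ∑ y, (∏ u, (starRingEnd ℂ) (wv (x u) (y u))) * φ y

/-- Measurement outcome distribution. -/
def pr (φ : (Fin n → Fin d) → ℂ) (x : Fin n → Out d) : ℝ := ‖amp φ x‖ ^ 2

lemma pr_complex (φ : (Fin n → Fin d) → ℂ) (x : Fin n → Out d) :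
    (pr φ x : ℂ) = ∑ y', ∑ y, (∏ u, wv (x u) (y' u) * (starRingEnd ℂ) (wv (x u) (y u))) *
      (φ y * (starRingEnd ℂ) (φ y')) := by
  have : (pr φ x : ℂ) = (starRingEnd ℂ) (amp φ x) * amp φ x := by
    rw [Complex.conj_mul']; simp [pr]
  rw [this]
  unfold amp
  rw [map_sum, Finset.sum_mul]
  refine Finset.sum_congr rfl fun y' _ => ?_
  rw [Finset.mul_sum]
  refine Finset.sum_congr rfl fun y _ => ?_
  simp only [map_mul, map_prod, Complex.conj_conj, Finset.prod_mul_distrib]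
  ring

/-- Coefficients of the measurement expansion. -/
def coef (e : Finset (Fin n)) (M : Matrix ({u // u ∈ e} → Fin d) ({u // u ∈ e} → Fin d) ℂ)
    (x : Fin n → Out d) : ℂ :=
  M (fun u => (x u.1).1) (fun u => (x u.1).2.1) *
    ∏ u, (if u ∈ e then 2 * d * I ^ ((x u).2.2 : ℕ) else 1)

lemma expand (hd : 0 < d) (e : Finset (Fin n))
    (M : Matrix ({u // u ∈ e} → Fin d) ({u // u ∈ e} → Fin d) ℂ) (y' y : Fin n → Fin d) :
    ∑ x : Fin n → Out d, coef e M x *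
        ∏ u, wv (x u) (y' u) * (starRingEnd ℂ) (wv (x u) (y u)) =
      (if ∀ u ∉ e, y' u = y u then (1 : ℂ) else 0) * M (fun u => y' u.1) (fun u => y u.1) := by
  classical
  let ind : ({u // u ∈ e} → Fin d) → ({u // u ∈ e} → Fin d) → Fin n → Out d → ℂ :=
    fun α β u x => if (∀ h : u ∈ e, x.1 = α ⟨u, h⟩ ∧ x.2.1 = β ⟨u, h⟩) then 1 else 0
  let G : ({u // u ∈ e} → Fin d) → ({u // u ∈ e} → Fin d) → Fin n → Out d → ℂ :=
    fun α β u x => ind α β u x * (if u ∈ e then 2 * d * I ^ (x.2.2 : ℕ) else 1) *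
      (wv x (y' u) * (starRingEnd ℂ) (wv x (y u)))
  have hx : ∀ x : Fin n → Out d, coef e M x *
        ∏ u, wv (x u) (y' u) * (starRingEnd ℂ) (wv (x u) (y u)) =
        ∑ α, ∑ β, M α β * ∏ u, G α β u (x u) := by
    intro x
    have hind : ∀ α β, ∏ u, ind α β u (x u) =
        if (fun u : {u // u ∈ e} => (x u.1).1) = α then
          (if (fun u : {u // u ∈ e} => (x u.1).2.1) = β then 1 else 0) else 0 := by
      intro α β
      simp only [ind, Finset.prod_boole, Finset.mem_univ, true_imp_iff]
      rw [← ite_and]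
      refine if_congr ?_ rfl rfl
      constructor
      · intro h
        exact ⟨funext fun u => (h u.1 u.2).1, funext fun u => (h u.1 u.2).2⟩
      · rintro ⟨rfl, rfl⟩ u h
        exact ⟨rfl, rfl⟩
    simp only [G, Finset.prod_mul_distrib, hind, coef]
    simp [Finset.sum_ite_eq, mul_assoc]
  have hG : ∀ α β u, ∑ x : Out d, G α β u x =
      if (∀ h : u ∈ e, y' u = α ⟨u, h⟩ ∧ y u = β ⟨u, h⟩) ∧ (u ∉ e → y' u = y u) then 1 else 0 := by
    intro α β u
    by_cases hu : u ∈ e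
    · simp only [G, ind, hu, forall_true_left, if_true, not_true, false_imp_iff, and_true]
      rw [← site1 hd]
      simp only [Fintype.sum_prod_type, ite_and, ite_mul, one_mul, zero_mul]
      rw [Finset.sum_eq_single (α ⟨u, hu⟩) (by intro b _ hb; simp [hb]) (by simp),
        Finset.sum_eq_single (β ⟨u, hu⟩) (by intro b _ hb; simp [hb]) (by simp)]
      simp
    · simp [G, ind, hu, site2 hd]
  simp only [hx]
  have hsw : ∑ x : Fin n → Out d, ∑ α, ∑ β, M α β * ∏ u, G α β u (x u) =
      ∑ α, ∑ β, M α β * ∏ u, ∑ x : Out d, G α β u x := by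
    rw [Finset.sum_comm]
    refine Finset.sum_congr rfl fun α _ => ?_
    rw [Finset.sum_comm]
    refine Finset.sum_congr rfl fun β _ => ?_
    rw [← Finset.mul_sum, Finset.prod_univ_sum, Fintype.piFinset_univ]
  rw [hsw]
  simp only [hG, Finset.prod_boole, Finset.mem_univ, true_imp_iff]
  have hcond : ∀ α β, (if ∀ u, (∀ h : u ∈ e, y' u = α ⟨u, h⟩ ∧ y u = β ⟨u, h⟩) ∧
      (u ∉ e → y' u = y u) then (1 : ℂ) else 0) =
      if (fun u : {u // u ∈ e} => y' u.1) = α then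
        (if (fun u : {u // u ∈ e} => y u.1) = β then
          (if ∀ u ∉ e, y' u = y u then (1 : ℂ) else 0) else 0) else 0 := by
    intro α β
    rw [← ite_and, ← ite_and]
    refine if_congr ?_ rfl rfl
    constructor
    · intro h
      exact ⟨⟨funext fun u => ((h u.1).1 u.2).1, funext fun u => ((h u.1).1 u.2).2⟩,
        fun u hu => (h u).2 hu⟩
    · rintro ⟨⟨rfl, rfl⟩, h⟩ u
      exact ⟨fun _ => ⟨rfl, rfl⟩, h u⟩
  simp only [hcond]
  simp [Finset.sum_ite_eq, mul_comm]

lemma energy_expand (hd : 0 < d) (A : Matrix (Fin n → Fin d) (Fin n → Fin d) ℂ)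
    (e : Finset (Fin n)) (M : Matrix ({u // u ∈ e} → Fin d) ({u // u ∈ e} → Fin d) ℂ)
    (hA : ∀ x y, A x y = (if ∀ u ∉ e, x u = y u then (1 : ℂ) else 0) *
        M (fun u => x u.1) (fun u => y u.1)) (φ : (Fin n → Fin d) → ℂ) :
    energy A (vecState φ) = ∑ x, pr φ x * (coef e M x).re := by
  have h1 : (A * vecState φ).trace = ∑ x, (pr φ x : ℂ) * coef e M x := by
    simp only [pr_complex, Finset.sum_mul]
    rw [Finset.sum_comm]
    simp only [Matrix.trace, Matrix.diag, Matrix.mul_apply, vecState]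
    refine Finset.sum_congr rfl fun y' _ => ?_
    rw [Finset.sum_comm]
    refine Finset.sum_congr rfl fun y _ => ?_
    rw [hA, ← expand hd e M y' y, Finset.sum_mul]
    exact Finset.sum_congr rfl fun x _ => by ring
  unfold energy
  rw [h1, Complex.re_sum]
  exact Finset.sum_congr rfl fun x _ => by rw [Complex.re_ofReal_mul]

lemma sum_pr (hd : 0 < d) (φ : (Fin n → Fin d) → ℂ) : ∑ x, pr φ x = ∑ y, ‖φ y‖ ^ 2 := by
  have h := energy_expand hd (1 : Matrix (Fin n → Fin d) (Fin n → Fin d) ℂ) ∅ (fun _ _ => 1)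
    (by intro x y; simp [Matrix.one_apply, funext_iff]) φ
  simp only [coef, Finset.notMem_empty, if_false, Finset.prod_const_one, mul_one, Complex.one_re]
    at h
  rw [← h]
  simp [energy, Matrix.trace, vecState, Complex.mul_conj, Complex.normSq_eq_norm_sq]
  norm_cast

lemma entry_le {m : Type*} [Fintype m] [DecidableEq m] (A : Matrix m m ℂ) (i j : m) :
    ‖A i j‖ ≤ opNorm A := by
  have h1 : (Matrix.toEuclideanCLM (𝕜 := ℂ) A (EuclideanSpace.single j 1)) i = A i j := by
    simp [Matrix.ofLp_toEuclideanCLM, Matrix.mulVec_single_one]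
  rw [← h1]
  refine (PiLp.norm_apply_le _ i).trans ?_
  refine (ContinuousLinearMap.le_opNorm _ _).trans ?_
  simp [opNorm]

lemma term_rep (hd : 0 < d) (A : Matrix (Fin n → Fin d) (Fin n → Fin d) ℂ)
    (e : Finset (Fin n)) (hA : ActsOn A e) (hn : opNorm A ≤ 1) :
    ∃ c : (Fin n → Out d) → ℝ, Dep e c ∧ (∀ x, |c x| ≤ (2 * d) ^ e.card) ∧
      ∀ φ, energy A (vecState φ) = ∑ x, pr φ x * c x := by
  obtain ⟨M, hM⟩ := hA
  refine ⟨fun x => (coef e M x).re, ?_, ?_, energy_expand hd A e M hM⟩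
  · intro x x' h
    have : coef e M x = coef e M x' := by
      unfold coef
      congr 1
      · congr 1 <;> ext u <;> rw [h u.1 u.2]
      · refine Finset.prod_congr rfl fun u _ => ?_
        split_ifs with hu
        · rw [h u hu]
        · rfl
    simp only [this]
  · intro x
    refine (Complex.abs_re_le_norm _).trans ?_
    unfold coef
    rw [norm_mul, norm_prod]
    have h1 : ‖M (fun u => (x u.1).1) (fun u => (x u.1).2.1)‖ ≤ 1 := by
      have h2 := hM (fun u => (x u).1) (fun u => if u ∈ e then (x u).2.1 else (x u).1)
      have h3 : ∀ u ∉ e, (x u).1 = if u ∈ e then (x u).2.1 else (x u).1 := by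
        intro u hu; simp [hu]
      rw [if_pos h3, one_mul] at h2
      have h4 : (fun u : {u // u ∈ e} => if u.1 ∈ e then (x u.1).2.1 else (x u.1).1) =
          fun u => (x u.1).2.1 := by
        ext u; simp [u.2]
      rw [h4] at h2
      rw [← h2]
      exact (entry_le _ _ _).trans hn
    have h5 : ∏ u, ‖(if u ∈ e then 2 * (d : ℂ) * I ^ ((x u).2.2 : ℕ) else 1)‖ =
        (2 * d) ^ e.card := by
      have : ∀ u, ‖(if u ∈ e then 2 * (d : ℂ) * I ^ ((x u).2.2 : ℕ) else 1)‖ =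
          if u ∈ e then (2 * d : ℝ) else 1 := by
        intro u; split_ifs <;> simp
      simp only [this]
      rw [Finset.prod_ite_mem, Finset.univ_inter, Finset.prod_const]
    rw [h5]
    exact mul_le_of_le_one_left (by positivity) h1

/-- Single site amplitude. -/
def sa (g : Fin d → ℂ) (b : Out d) : ℂ := ∑ a, (starRingEnd ℂ) (wv b a) * g a

lemma sum_sa (hd : 0 < d) (g : Fin d → ℂ) : ∑ b, ‖sa g b‖ ^ 2 = ∑ a, ‖g a‖ ^ 2 := by
  have h : ∀ b, ((‖sa g b‖ ^ 2 : ℝ) : ℂ) = ∑ a', ∑ a, (wv b a' * (starRingEnd ℂ) (wv b a)) *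
      (g a * (starRingEnd ℂ) (g a')) := by
    intro b
    have : ((‖sa g b‖ ^ 2 : ℝ) : ℂ) = (starRingEnd ℂ) (sa g b) * sa g b := by
      rw [Complex.conj_mul']; simp
    rw [this]
    unfold sa
    rw [map_sum, Finset.sum_mul]
    refine Finset.sum_congr rfl fun y' _ => ?_
    rw [Finset.mul_sum]
    refine Finset.sum_congr rfl fun y _ => ?_
    simp only [map_mul, Complex.conj_conj]
    ring
  have h2 : ((∑ b, ‖sa g b‖ ^ 2 : ℝ) : ℂ) = ((∑ a, ‖g a‖ ^ 2 : ℝ) : ℂ) := by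
    rw [Complex.ofReal_sum]
    simp only [h]
    rw [Finset.sum_comm, Complex.ofReal_sum]
    refine Finset.sum_congr rfl fun a' _ => ?_
    rw [Finset.sum_comm]
    simp only [← Finset.sum_mul, site2 hd, ite_mul, one_mul, zero_mul, Finset.sum_ite_eq,
      Finset.mem_univ, if_true]
    rw [Complex.mul_conj']; simp
  exact_mod_cast h2

lemma pr_prod (ψ : Fin n → Fin d → ℂ) (x : Fin n → Out d) :
    pr (fun y => ∏ u, ψ u (y u)) x = ∏ u, ‖sa (ψ u) (x u)‖ ^ 2 := by
  unfold pr amp sa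
  rw [Finset.prod_pow, ← norm_prod, Finset.prod_univ_sum, Fintype.piFinset_univ]
  simp only [Finset.prod_mul_distrib]

/-- Post-measurement vector at site `u`. -/
def gv (φ : (Fin n → Fin d) → ℂ) (u : Fin n) (z : Fin n → Out d) (a : Fin d) : ℂ :=
  ∑ y, if y u = a then (∏ v ∈ Finset.univ.erase u, (starRingEnd ℂ) (wv (z v) (y v))) * φ y else 0

lemma sa_gv (φ : (Fin n → Fin d) → ℂ) (u : Fin n) (z : Fin n → Out d) (b : Out d) :
    sa (gv φ u z) b = amp φ (Function.update z u b) := by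
  unfold sa gv amp
  simp only [Finset.mul_sum]
  rw [Finset.sum_comm]
  refine Finset.sum_congr rfl fun y _ => ?_
  simp only [mul_ite, mul_zero, Finset.sum_ite_eq, Finset.mem_univ, if_true]
  rw [← Finset.mul_prod_erase Finset.univ
    (fun v => (starRingEnd ℂ) (wv (Function.update z u b v) (y v))) (Finset.mem_univ u)]
  have : ∏ v ∈ Finset.univ.erase u, (starRingEnd ℂ) (wv (Function.update z u b v) (y v)) =
      ∏ v ∈ Finset.univ.erase u, (starRingEnd ℂ) (wv (z v) (y v)) :=
    Finset.prod_congr rfl fun v hv => by simp [Finset.ne_of_mem_erase hv]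
  rw [this]
  simp [mul_assoc]

lemma sum_agr_erase {V X : Type*} [Fintype V] [DecidableEq V] [Fintype X] [DecidableEq X]
    (u : V) (z : V → X) (F : (V → X) → ℝ) :
    ∑ z', agr (Finset.univ.erase u) z z' * F z' = ∑ b, F (Function.update z u b) := by
  have h1 : ∀ b, F (Function.update z u b) =
      ∑ z', if z' = Function.update z u b then F z' else 0 := by intro b; simp
  simp only [h1]
  rw [Finset.sum_comm]
  refine Finset.sum_congr rfl fun z' _ => ?_
  have h2 : ∀ b, (z' = Function.update z u b) ↔
      (z' u = b ∧ ∀ v ∈ Finset.univ.erase u, z' v = z v) := by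
    intro b
    constructor
    · rintro rfl
      refine ⟨by simp, fun v hv => ?_⟩
      simp [Finset.ne_of_mem_erase hv]
    · rintro ⟨rfl, h⟩
      ext v
      by_cases hv : v = u
      · subst hv; simp
      · simp [hv, h v (by simp [hv])]
  simp only [h2, ite_and, Finset.sum_ite_eq, Finset.mem_univ, if_true, agr]
  split_ifs <;> simp

lemma cE_erase {V X : Type*} [Fintype V] [DecidableEq V] [Fintype X] [DecidableEq X]
    (p : (V → X) → ℝ) (u : V) (z : V → X) (b : X) :
    cE p (Finset.univ.erase u) (one u b) z =
      p (Function.update z u b) / ∑ b', p (Function.update z u b') := by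
  unfold cE mass
  rw [sum_agr_erase u z p, sum_agr_erase u z (fun z => p z * one u b z)]
  simp [one]

lemma site_state (hd : 0 < d) (φ : (Fin n → Fin d) → ℂ) (u : Fin n) (z : Fin n → Out d)
    (hz : 0 < pr φ z) :
    ∃ ψ : Fin d → ℂ, ∑ a, ‖ψ a‖ ^ 2 = 1 ∧
      ∀ b, ‖sa ψ b‖ ^ 2 = cE (pr φ) (Finset.univ.erase u) (one u b) z := by
  have hN : ∑ b', pr φ (Function.update z u b') = ∑ a, ‖gv φ u z a‖ ^ 2 := by
    rw [← sum_sa hd]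
    simp only [sa_gv, pr]
  set N := ∑ a, ‖gv φ u z a‖ ^ 2 with hNdef
  have hNpos : 0 < N := by
    rw [← hN]
    refine Finset.sum_pos' (fun b _ => by unfold pr; positivity) ⟨z u, Finset.mem_univ _, ?_⟩
    simpa using hz
  have hs : ‖(((Real.sqrt N)⁻¹ : ℝ) : ℂ)‖ ^ 2 = N⁻¹ := by
    rw [Complex.norm_real, Real.norm_eq_abs, sq_abs, inv_pow, Real.sq_sqrt hNpos.le]
  refine ⟨fun a => (((Real.sqrt N)⁻¹ : ℝ) : ℂ) * gv φ u z a, ?_, fun b => ?_⟩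
  · simp only [norm_mul, mul_pow, hs, ← Finset.mul_sum]
    exact inv_mul_cancel₀ hNpos.ne'
  · have : sa (fun a => (((Real.sqrt N)⁻¹ : ℝ) : ℂ) * gv φ u z a) b =
        (((Real.sqrt N)⁻¹ : ℝ) : ℂ) * amp φ (Function.update z u b) := by
      rw [← sa_gv]
      unfold sa
      rw [Finset.mul_sum]
      exact Finset.sum_congr rfl fun a _ => by ring
    rw [this, cE_erase, hN, norm_mul, mul_pow, hs]
    unfold pr
    rw [div_eq_inv_mul]

lemma energy_sum {ι : Type*} {m : Type*} [Fintype m] (E : Finset ι) (h : ι → Matrix m m ℂ)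
    (ρ : Matrix m m ℂ) : energy (∑ e ∈ E, h e) ρ = ∑ e ∈ E, energy (h e) ρ := by
  simp [energy, Finset.sum_mul, Matrix.trace_sum]

end Quantum

/-- For all fixed `k` and `d` there is a constant `C` such that every
`k`-local Hamiltonian on `n` qudits of local dimension `d` with `m` interactions of operator
norm at most 1 admits a pure product state whose energy is within
`C·n^{(k−1)/3}·m^{2/3}` of the minimum over all unit vectors. -/
theorem pure_product_state_approximation_klocal :
    ∀ k d : ℕ, 0 < k → 0 < d → ∃ C : ℝ, 0 < C ∧
      ∀ (n : ℕ) (E : Finset (Finset (Fin n)))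
        (h : Finset (Fin n) → Matrix (Fin n → Fin d) (Fin n → Fin d) ℂ),
        (∀ e ∈ E, e.card = k) →
        (∀ e ∈ E, (h e).IsHermitian) →
        (∀ e ∈ E, ActsOn (h e) e) →
        (∀ e ∈ E, opNorm (h e) ≤ 1) →
        ∃ ψ : Fin n → Fin d → ℂ,
          (∀ u, ∑ i, ‖ψ u i‖ ^ 2 = 1) ∧
          energy (∑ e ∈ E, h e) (vecState (fun x => ∏ u, ψ u (x u))) ≤
            sInf {x : ℝ | ∃ φ : (Fin n → Fin d) → ℂ,
                (∑ z, ‖φ z‖ ^ 2 = 1) ∧ x = energy (∑ e ∈ E, h e) (vecState φ)} +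
              C * (n : ℝ) ^ (((k : ℝ) - 1) / 3) * (E.card : ℝ) ^ ((2 : ℝ) / 3) := by
  intro k d hk hd
  refine ⟨(2 * d) ^ k * (2 + k + k * Fintype.card (Out d)) + 1, by positivity, ?_⟩
  intro n E h hcard _ hact hnorm
  rcases Nat.eq_zero_or_pos E.card with hE0 | hEpos
  · have hE : E = ∅ := Finset.card_eq_zero.1 hE0
    subst hE
    refine ⟨fun _ i => if i = ⟨0, hd⟩ then 1 else 0, fun u => ?_, ?_⟩
    · rw [Finset.sum_eq_single (⟨0, hd⟩ : Fin d)] <;> simp +contextual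
    · have h0 : ∀ ρ : Matrix (Fin n → Fin d) (Fin n → Fin d) ℂ,
          energy (∑ e ∈ (∅ : Finset (Finset (Fin n))), h e) ρ = 0 := by
        intro ρ; simp [energy]
      rw [h0]
      refine add_nonneg (Real.sInf_nonneg ?_) (by positivity)
      rintro x ⟨φ, -, rfl⟩
      rw [h0]
  · have hn : 0 < n := by
      obtain ⟨e, he⟩ := Finset.card_pos.1 hEpos
      have h1 := Finset.card_le_univ e
      rw [hcard e he, Fintype.card_fin] at h1
      omega
    have hnR : (0 : ℝ) < n := by exact_mod_cast hn
    have hmR : (0 : ℝ) < E.card := by exact_mod_cast hEpos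
    set Y : ℝ := (n : ℝ) ^ (((k : ℝ) - 1) / 3) * (E.card : ℝ) ^ ((2 : ℝ) / 3) with hYdef
    have hY : 0 < Y := by positivity
    have hY3 : Y ^ 3 = (E.card : ℝ) ^ 2 * (Fintype.card (Fin n) : ℝ) ^ (k - 1) := by
      rw [hYdef, mul_pow, ← Real.rpow_natCast, ← Real.rpow_natCast, ← Real.rpow_mul hnR.le,
        ← Real.rpow_mul hmR.le, Fintype.card_fin, mul_comm]
      congr 1
      · rw [← Real.rpow_natCast]; norm_num
      · rw [← Real.rpow_natCast, Nat.cast_sub hk]; norm_num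
    set s : Set ℝ := {x : ℝ | ∃ φ : (Fin n → Fin d) → ℂ,
                (∑ z, ‖φ z‖ ^ 2 = 1) ∧ x = energy (∑ e ∈ E, h e) (vecState φ)} with hs
    have hne : s.Nonempty := by
      refine ⟨_, fun y => if y = (fun _ => ⟨0, hd⟩) then 1 else 0, ?_, rfl⟩
      rw [Finset.sum_eq_single (fun _ => (⟨0, hd⟩ : Fin d))] <;> simp +contextual
    obtain ⟨x, ⟨φ, hφ, rfl⟩, hlt⟩ := exists_lt_of_csInf_lt hne (lt_add_of_pos_right (sInf s) hY)
    have hrep : ∀ e, ∃ c : (Fin n → Out d) → ℝ, e ∈ E → (Dep e c ∧ (∀ x, |c x| ≤ (2 * d) ^ k) ∧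
        ∀ φ, energy (h e) (vecState φ) = ∑ x, pr φ x * c x) := by
      intro e
      by_cases he : e ∈ E
      · obtain ⟨c, h1, h2, h3⟩ := term_rep hd (h e) e (hact e he) (hnorm e he)
        rw [hcard e he] at h2
        exact ⟨c, fun _ => ⟨h1, h2, h3⟩⟩
      · exact ⟨0, fun h => absurd h he⟩
    choose c hc using hrep
    have hen : ∀ φ, energy (∑ e ∈ E, h e) (vecState φ) = ∑ x, pr φ x * ∑ e ∈ E, c e x := by
      intro φ
      rw [energy_sum, Finset.sum_congr rfl fun e he => (hc e he).2.2 φ, Finset.sum_comm]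
      simp only [Finset.mul_sum]
    obtain ⟨z, hz, hle⟩ := classical_main (p := pr φ) (fun x => by unfold pr; positivity)
      ((sum_pr hd φ).trans hφ) E k hcard c ((2 * d) ^ k) (by positivity)
      (fun e he => (hc e he).2.1) (fun e he => (hc e he).1) Y hY hY3 hEpos (by simpa using hn)
    choose ψ hψ1 hψ2 using fun u => site_state hd φ u (z u) (hz u)
    refine ⟨ψ, hψ1, ?_⟩
    rw [hen]
    simp only [pr_prod, hψ2]
    rw [hen] at hlt
    rw [mul_assoc, ← hYdef]
    linarith

end QLH
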